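/- arXiv:2304.14624 — 5 statements merged into one kernel-verified Lean document; each statement's English description precedes it below -/
import Mathlib

section
/- Let m ≥ 1. For all M ∈ k and N ∈ p, the matrix commutator ⁅M, N⁆ = M*N - N*M lies in p, where k = {σ0⊗A + σ3⊗B : A ∈ su(m), B ∈ u(m)} and p = {σ1⊗A + σ2⊗B : A, B ∈ u(m)}. -/
open Matrix Kronecker Complex

noncomputable section

/-- The 2×2 identity matrix (σ₀). -/
def σ0 : Matrix (Fin 2) (Fin 2) ℂ := 1
/-- Pauli matrix σ₁. -/
def σ1 : Matrix (Fin 2) (Fin 2) ℂ := !![0, 1; 1, 0]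
/-- Pauli matrix σ₂. -/
def σ2 : Matrix (Fin 2) (Fin 2) ℂ := !![0, -Complex.I; Complex.I, 0]
/-- Pauli matrix σ₃. -/
def σ3 : Matrix (Fin 2) (Fin 2) ℂ := !![1, 0; 0, -1]

/-- su(m): traceless skew-Hermitian m×m complex matrices. -/
def su (m : ℕ) : Set (Matrix (Fin m) (Fin m) ℂ) :=
  {A | A.trace = 0 ∧ Aᴴ = -A}

/-- u(m): skew-Hermitian m×m complex matrices. -/
def uAlg (m : ℕ) : Set (Matrix (Fin m) (Fin m) ℂ) :=
  {A | Aᴴ = -A}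

/-- t(m): diagonal m×m matrices with purely imaginary diagonal entries. -/
def tAlg (m : ℕ) : Set (Matrix (Fin m) (Fin m) ℂ) :=
  {A | ∃ d : Fin m → ℝ, A = Matrix.diagonal fun i => (d i : ℂ) * Complex.I}

/-- k = {σ0⊗A + σ3⊗B : A ∈ su(m), B ∈ u(m)}. -/
def kSet (m : ℕ) : Set (Matrix (Fin 2 × Fin m) (Fin 2 × Fin m) ℂ) :=
  {M | ∃ A ∈ su m, ∃ B ∈ uAlg m, M = σ0 ⊗ₖ A + σ3 ⊗ₖ B}


/-- p = {σ1⊗A + σ2⊗B : A, B ∈ u(m)}. -/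
def pSet (m : ℕ) : Set (Matrix (Fin 2 × Fin m) (Fin 2 × Fin m) ℂ) :=
  {M | ∃ A ∈ uAlg m, ∃ B ∈ uAlg m, M = σ1 ⊗ₖ A + σ2 ⊗ₖ B}

lemma pauli_bracket {m : ℕ} (A B C D : Matrix (Fin m) (Fin m) ℂ) :
    ⁅σ0 ⊗ₖ A + σ3 ⊗ₖ B, σ1 ⊗ₖ C + σ2 ⊗ₖ D⁆ =
      σ1 ⊗ₖ (⁅A, C⁆ - Complex.I • (B * D + D * B)) +
        σ2 ⊗ₖ (⁅A, D⁆ + Complex.I • (B * C + C * B)) := by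
  have h31 : σ3 * σ1 = Complex.I • σ2 := by
    ext i j; fin_cases i <;> fin_cases j <;> simp [σ1, σ2, σ3]
  have h13 : σ1 * σ3 = -(Complex.I • σ2) := by
    ext i j; fin_cases i <;> fin_cases j <;> simp [σ1, σ2, σ3]
  have h32 : σ3 * σ2 = -(Complex.I • σ1) := by
    ext i j; fin_cases i <;> fin_cases j <;> simp [σ1, σ2, σ3]
  have h23 : σ2 * σ3 = Complex.I • σ1 := by
    ext i j; fin_cases i <;> fin_cases j <;> simp [σ1, σ2, σ3]
  simp only [Ring.lie_def, mul_add, add_mul, ← mul_kronecker_mul, h31, h13, h32, h23]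
  ext ⟨i, k⟩ ⟨j, l⟩
  simp [σ0, kroneckerMap_apply]
  ring

lemma lie_mem_uAlg {m : ℕ} {A B : Matrix (Fin m) (Fin m) ℂ} (hA : A ∈ uAlg m)
    (hB : B ∈ uAlg m) : ⁅A, B⁆ ∈ uAlg m := by
  rw [uAlg, Set.mem_ofPred_eq] at *
  simp [Ring.lie_def, hA, hB]

lemma I_smul_anticommutator_mem_uAlg {m : ℕ} {A B : Matrix (Fin m) (Fin m) ℂ}
    (hA : A ∈ uAlg m) (hB : B ∈ uAlg m) : Complex.I • (A * B + B * A) ∈ uAlg m := by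
  rw [uAlg, Set.mem_ofPred_eq] at *
  simp [hA, hB, add_comm]

lemma add_mem_uAlg {m : ℕ} {A B : Matrix (Fin m) (Fin m) ℂ} (hA : A ∈ uAlg m)
    (hB : B ∈ uAlg m) : A + B ∈ uAlg m := by
  rw [uAlg, Set.mem_ofPred_eq] at *
  simp [hA, hB, add_comm]

lemma sub_mem_uAlg {m : ℕ} {A B : Matrix (Fin m) (Fin m) ℂ} (hA : A ∈ uAlg m)
    (hB : B ∈ uAlg m) : A - B ∈ uAlg m := by
  rw [uAlg, Set.mem_ofPred_eq] at *
  rw [conjTranspose_sub, hA, hB]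
  abel

/-- ⁅k, p⁆ ⊆ p. -/
theorem k_bracket_p_mem_p (m : ℕ) (hm : 1 ≤ m)
    (M N : Matrix (Fin 2 × Fin m) (Fin 2 × Fin m) ℂ)
    (hM : M ∈ kSet m) (hN : N ∈ pSet m) :
    ⁅M, N⁆ ∈ pSet m := by
  obtain ⟨A, ⟨-, hA⟩, B, hB, rfl⟩ := hM
  obtain ⟨C, hC, D, hD, rfl⟩ := hN
  exact ⟨_, sub_mem_uAlg (lie_mem_uAlg hA hC) (I_smul_anticommutator_mem_uAlg hB hD),
    _, add_mem_uAlg (lie_mem_uAlg hA hD) (I_smul_anticommutator_mem_uAlg hB hC),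
    pauli_bracket A B C D⟩
end
end

section
/- Let m ≥ 1. Every element of p lies in the real span of the set of commutators {⁅M, N⁆ : M ∈ k, N ∈ p}; that is, ⁅k, p⁆ = p (not merely ⁅k, p⁆ ⊆ p), where k = {σ0⊗A + σ3⊗B : A ∈ su(m), B ∈ u(m)} and p = {σ1⊗A + σ2⊗B : A, B ∈ u(m)}. -/
open Matrix Kronecker Complex

noncomputable section

theorem σ3_mul_σ1 : σ3 * σ1 = Complex.I • σ2 := by
  ext i j; fin_cases i <;> fin_cases j <;> simp [σ1, σ2, σ3]

theorem σ1_mul_σ3 : σ1 * σ3 = -(Complex.I • σ2) := by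
  ext i j; fin_cases i <;> fin_cases j <;> simp [σ1, σ2, σ3]

theorem σ3_mul_σ2 : σ3 * σ2 = -(Complex.I • σ1) := by
  ext i j; fin_cases i <;> fin_cases j <;> simp [σ1, σ2, σ3]

theorem σ2_mul_σ3 : σ2 * σ3 = Complex.I • σ1 := by
  ext i j; fin_cases i <;> fin_cases j <;> simp [σ1, σ2, σ3]

theorem neg_kronecker {l n : Type*} (A : Matrix l l ℂ) (B : Matrix n n ℂ) :
    (-A) ⊗ₖ B = -(A ⊗ₖ B) := by
  ext; simp

theorem kronecker_neg {l n : Type*} (A : Matrix l l ℂ) (B : Matrix n n ℂ) :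
    A ⊗ₖ (-B) = -(A ⊗ₖ B) := by
  ext; simp

theorem lie_pauli_kronecker {n : Type*} [Fintype n] [DecidableEq n] (A B C D : Matrix n n ℂ) :
    ⁅σ0 ⊗ₖ A + σ3 ⊗ₖ B, σ1 ⊗ₖ C + σ2 ⊗ₖ D⁆ =
      σ1 ⊗ₖ (A * C - C * A - Complex.I • (B * D + D * B)) +
        σ2 ⊗ₖ (A * D - D * A + Complex.I • (B * C + C * B)) := by
  simp only [Ring.lie_def, add_mul, mul_add, ← mul_kronecker_mul, σ3_mul_σ1, σ1_mul_σ3,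
    σ3_mul_σ2, σ2_mul_σ3, neg_kronecker, kronecker_neg, smul_kronecker, kronecker_smul,
    σ0, one_mul, mul_one, smul_add, sub_eq_add_neg, neg_add, kronecker_add]
  abel

theorem lie_sub_smul_mem_uAlg {m : ℕ} {A B C D : Matrix (Fin m) (Fin m) ℂ}
    (hA : A ∈ uAlg m) (hB : B ∈ uAlg m) (hC : C ∈ uAlg m) (hD : D ∈ uAlg m) :
    A * C - C * A - Complex.I • (B * D + D * B) ∈ uAlg m := by
  simp only [uAlg, Set.mem_ofPred_eq] at *
  simp only [conjTranspose_sub, conjTranspose_add, conjTranspose_mul, conjTranspose_smul,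
    hA, hB, hC, hD, neg_mul_neg, Complex.star_def, Complex.conj_I, neg_smul, smul_add]
  abel

theorem neg_mem_uAlg {m : ℕ} {A : Matrix (Fin m) (Fin m) ℂ} (hA : A ∈ uAlg m) :
    -A ∈ uAlg m := by
  simp only [uAlg, Set.mem_ofPred_eq] at *
  rw [conjTranspose_neg, hA]

/-- The real subspace with carrier `pSet m`. -/
def pSubmodule (m : ℕ) : Submodule ℝ (Matrix (Fin 2 × Fin m) (Fin 2 × Fin m) ℂ) where
  carrier := pSet m
  zero_mem' := ⟨0, by simp [uAlg], 0, by simp [uAlg], by simp⟩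
  add_mem' := by
    rintro _ _ ⟨A, hA, B, hB, rfl⟩ ⟨C, hC, D, hD, rfl⟩
    simp only [uAlg, Set.mem_ofPred_eq] at hA hB hC hD
    refine ⟨A + C, ?_, B + D, ?_, ?_⟩
    · simp only [uAlg, Set.mem_ofPred_eq, conjTranspose_add, hA, hC, neg_add]
    · simp only [uAlg, Set.mem_ofPred_eq, conjTranspose_add, hB, hD, neg_add]
    · simp only [kronecker_add]
      abel
  smul_mem' := by
    rintro r _ ⟨A, hA, B, hB, rfl⟩
    simp only [uAlg, Set.mem_ofPred_eq] at hA hB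
    refine ⟨r • A, ?_, r • B, ?_, ?_⟩
    · simp [uAlg, conjTranspose_smul, hA]
    · simp [uAlg, conjTranspose_smul, hB]
    · simp only [kronecker_smul, smul_add]

theorem lie_mem_pSet {m : ℕ} {M N : Matrix (Fin 2 × Fin m) (Fin 2 × Fin m) ℂ}
    (hM : M ∈ kSet m) (hN : N ∈ pSet m) : ⁅M, N⁆ ∈ pSet m := by
  obtain ⟨A, ⟨-, hA⟩, B, hB, rfl⟩ := hM
  obtain ⟨C, hC, D, hD, rfl⟩ := hN
  refine ⟨_, lie_sub_smul_mem_uAlg hA hB hC hD, _, ?_, lie_pauli_kronecker A B C D⟩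
  have h := lie_sub_smul_mem_uAlg hA hB hD (neg_mem_uAlg hC)
  rwa [mul_neg, neg_mul, ← neg_add, smul_neg, sub_neg_eq_add] at h

theorem exists_lie_eq_of_mem_pSet {m : ℕ} {X : Matrix (Fin 2 × Fin m) (Fin 2 × Fin m) ℂ}
    (hX : X ∈ pSet m) : ∃ M ∈ kSet m, ∃ N ∈ pSet m, X = ⁅M, N⁆ := by
  obtain ⟨A, hA, B, hB, rfl⟩ := hX
  have half (Y : Matrix (Fin m) (Fin m) ℂ) :
      Complex.I • ((Complex.I / 2) • Y + (Complex.I / 2) • Y) = -Y := by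
    rw [← add_smul, add_halves, smul_smul, Complex.I_mul_I, neg_one_smul]
  refine ⟨σ0 ⊗ₖ 0 + σ3 ⊗ₖ ((Complex.I / 2) • 1), ⟨0, by simp [su], _, ?_, rfl⟩,
    σ1 ⊗ₖ (-B) + σ2 ⊗ₖ A, ⟨-B, neg_mem_uAlg hB, A, hA, rfl⟩, ?_⟩
  · simp [uAlg, conjTranspose_smul, neg_div]
  · rw [lie_pauli_kronecker]
    simp only [zero_mul, mul_zero, sub_zero, zero_sub, zero_add, smul_mul_assoc,
      mul_smul_comm, one_mul, mul_one, half, neg_neg]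

/-- ⁅k, p⁆ = p: the real span of the commutators of elements of k with elements
of p is exactly p. -/
theorem k_bracket_p_eq_p (m : ℕ) (hm : 1 ≤ m) :
    (Submodule.span ℝ
        {X : Matrix (Fin 2 × Fin m) (Fin 2 × Fin m) ℂ |
          ∃ M ∈ kSet m, ∃ N ∈ pSet m, X = ⁅M, N⁆} :
      Set (Matrix (Fin 2 × Fin m) (Fin 2 × Fin m) ℂ)) = pSet m := by
  refine Set.Subset.antisymm ?_ fun X hX => Submodule.subset_span (exists_lie_eq_of_mem_pSet hX)
  change _ ≤ pSubmodule m
  rw [Submodule.span_le]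
  rintro _ ⟨M, hM, N, hN, rfl⟩
  exact lie_mem_pSet hM hN
end
end

section
/- Let m ≥ 1. The subspace a = {σ1⊗D : D ∈ t(m)} is a maximal abelian subalgebra of p = {σ1⊗A + σ2⊗B : A, B ∈ u(m)}: if M ∈ p commutes with every element of a (i.e., M*N = N*M for all N ∈ a), then M ∈ a. -/
open Matrix Kronecker Complex

noncomputable section

/-- a = {σ1⊗D : D ∈ t(m)}. -/
def aSet (m : ℕ) : Set (Matrix (Fin 2 × Fin m) (Fin 2 × Fin m) ℂ) :=
  {M | ∃ D ∈ tAlg m, M = σ1 ⊗ₖ D}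


/-- The upper-left block of the relation `[σ₁ ⊗ A + σ₂ ⊗ B, σ₁ ⊗ D] = 0`, entrywise. -/
lemma apply_mul_eq_of_commute {m : ℕ} {A B : Matrix (Fin m) (Fin m) ℂ}
    (hcomm : ∀ N ∈ aSet m, (σ1 ⊗ₖ A + σ2 ⊗ₖ B) * N = N * (σ1 ⊗ₖ A + σ2 ⊗ₖ B))
    (d : Fin m → ℝ) (i j : Fin m) :
    (A i j - I * B i j) * d j = d i * (A i j + I * B i j) := by
  have h := congrFun₂ (hcomm _ ⟨_, ⟨d, rfl⟩, rfl⟩) (0, i) (0, j)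
  simp only [mul_apply, Fintype.sum_prod_type, Fin.sum_univ_two] at h
  simp [σ1, σ2, kroneckerMap_apply, diagonal_apply] at h
  apply mul_right_cancel₀ I_ne_zero
  linear_combination h

/-- a is a maximal abelian subalgebra of p: any element of p commuting with all
of a lies in a. -/
theorem aSet_maximal_abelian (m : ℕ) (hm : 1 ≤ m)
    (M : Matrix (Fin 2 × Fin m) (Fin 2 × Fin m) ℂ) (hM : M ∈ pSet m)
    (hcomm : ∀ N ∈ aSet m, M * N = N * M) :
    M ∈ aSet m := by
  obtain ⟨A, hA, B, -, rfl⟩ := hM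
  have key := apply_mul_eq_of_commute hcomm
  have hB : B = 0 := by
    ext i j
    have h := key (fun _ => 1) i j
    simp only [ofReal_one] at h
    apply mul_left_cancel₀ I_ne_zero
    rw [Matrix.zero_apply]
    linear_combination -h / 2
  subst hB
  have hoff : ∀ i j, i ≠ j → A i j = 0 := by
    intro i j hij
    simpa [hij] using key (Pi.single j 1) i j
  refine ⟨A, ⟨fun i => (A i i).im, ?_⟩, by simp⟩
  ext i j
  rcases eq_or_ne i j with rfl | hij
  · have h : star (A i i) = -A i i := congrFun₂ hA i i
    have hre := congrArg re h
    simp only [star_def, conj_re, neg_re] at hre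
    apply Complex.ext
    · simpa using (by linarith : (A i i).re = 0)
    · simp
  · rw [hoff i j hij, diagonal_apply_ne _ hij]
end
end

section
/- Any two Pauli strings of the same length either commute or anticommute: for all n and all a, b : Fin n → Fin 4, the iterated Kronecker products P_a and P_b satisfy P_a * P_b = P_b * P_a or P_a * P_b = -(P_b * P_a). -/
open Matrix Complex

noncomputable section

/-- The Pauli matrices σ₀ (identity), σ₁, σ₂, σ₃, indexed by `Fin 4`. -/
def σ : Fin 4 → Matrix (Fin 2) (Fin 2) ℂ
  | 0 => 1
  | 1 => !![0, 1; 1, 0]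
  | 2 => !![0, -Complex.I; Complex.I, 0]
  | 3 => !![1, 0; 0, -1]

/-- The Pauli string σ_{a 0} ⊗ σ_{a 1} ⊗ ⋯ ⊗ σ_{a (n-1)}, realized as a matrix on
the n-fold product index `Fin n → Fin 2` (the entries of the iterated Kronecker
product). -/
def pauliString (n : ℕ) (a : Fin n → Fin 4) :
    Matrix (Fin n → Fin 2) (Fin n → Fin 2) ℂ :=
  Matrix.of fun x y => ∏ i, σ (a i) (x i) (y i)

theorem pauliString_mul_apply (n : ℕ) (a b : Fin n → Fin 4) (x y : Fin n → Fin 2) :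
    (pauliString n a * pauliString n b) x y = ∏ i, (σ (a i) * σ (b i)) (x i) (y i) := by
  simp only [pauliString, Matrix.mul_apply, Matrix.of_apply, ← Finset.prod_mul_distrib,
    Finset.prod_univ_sum, Fintype.piFinset_univ]

theorem σ_mul_eq_unit_smul (p q : Fin 4) : ∃ s : ℤˣ, σ p * σ q = s • (σ q * σ p) := by
  have h : σ p * σ q = σ q * σ p ∨ σ p * σ q = -(σ q * σ p) := by
    fin_cases p <;> fin_cases q <;> simp [σ]
  rcases h with h | h
  · exact ⟨1, by rw [h, one_smul]⟩
  · exact ⟨-1, by rw [h, Units.neg_smul, one_smul]⟩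

/-- Any two Pauli strings of the same length either commute or anticommute. -/
theorem pauliString_comm_or_anticomm (n : ℕ) (a b : Fin n → Fin 4) :
    pauliString n a * pauliString n b = pauliString n b * pauliString n a ∨
    pauliString n a * pauliString n b = -(pauliString n b * pauliString n a) := by
  choose s hs using fun i => σ_mul_eq_unit_smul (a i) (b i)
  have h : pauliString n a * pauliString n b =
      (∏ i, s i) • (pauliString n b * pauliString n a) := by
    ext x y
    simp only [Matrix.smul_apply, pauliString_mul_apply, hs, Finset.prod_smul]
  rcases Int.units_eq_one_or (∏ i, s i) with hp | hp
  · left; rw [h, hp, one_smul]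
  · right; rw [h, hp, Units.neg_smul, one_smul]
end
end

section
/- Let n ≥ 1 and a, b : Fin n → Fin 4 be such that the Pauli strings anticommute: P_a * P_b = -(P_b * P_a). Then there exist c : Fin n → Fin 4 and a sign s ∈ {1, -1} such that ⁅(i/2)•P_a, (i/2)•P_b⁆ = s • ((i/2)•P_c); in particular, the commutator of two (normalized) anticommuting Pauli strings is again, up to sign, a normalized Pauli string. -/
open Matrix Complex

noncomputable section

/-- Products of Pauli matrices are Pauli matrices up to a fourth root of unity, and swapping
the factors conjugates that phase. -/
theorem exists_σ_mul_σ (p q : Fin 4) :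
    ∃ r : Fin 4, ∃ z : ℂ, z ^ 4 = 1 ∧ σ p * σ q = z • σ r ∧ σ q * σ p = star z • σ r := by
  fin_cases p <;> fin_cases q
  · exact ⟨0, 1, by simp [σ, Matrix.one_fin_two]⟩
  · exact ⟨1, 1, by simp [σ, Matrix.one_fin_two]⟩
  · exact ⟨2, 1, by simp [σ, Matrix.one_fin_two]⟩
  · exact ⟨3, 1, by simp [σ, Matrix.one_fin_two]⟩
  · exact ⟨1, 1, by simp [σ, Matrix.one_fin_two]⟩
  · exact ⟨0, 1, by simp [σ, Matrix.one_fin_two]⟩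
  · exact ⟨3, Complex.I, by simp [σ]⟩
  · exact ⟨2, -Complex.I, by simp [σ, (show Even 4 by decide).neg_pow]⟩
  · exact ⟨2, 1, by simp [σ, Matrix.one_fin_two]⟩
  · exact ⟨3, -Complex.I, by simp [σ, (show Even 4 by decide).neg_pow]⟩
  · exact ⟨0, 1, by simp [σ, Matrix.one_fin_two]⟩
  · exact ⟨1, Complex.I, by simp [σ]⟩
  · exact ⟨3, 1, by simp [σ, Matrix.one_fin_two]⟩
  · exact ⟨2, Complex.I, by simp [σ]⟩
  · exact ⟨1, -Complex.I, by simp [σ, (show Even 4 by decide).neg_pow]⟩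
  · exact ⟨0, 1, by simp [σ, Matrix.one_fin_two]⟩

theorem σ_mul_self (p : Fin 4) : σ p * σ p = 1 := by
  fin_cases p <;> simp [σ, Matrix.one_fin_two]

theorem pauliString_mul_pauliString (n : ℕ) (a b : Fin n → Fin 4) :
    pauliString n a * pauliString n b =
      Matrix.of fun x y => ∏ i, (σ (a i) * σ (b i)) (x i) (y i) := by
  ext x y
  simp only [pauliString, Matrix.mul_apply, Matrix.of_apply, ← Finset.prod_mul_distrib,
    Fintype.prod_sum]

theorem pauliString_mul_pauliString_of_smul {n : ℕ} {a b c : Fin n → Fin 4} {z : Fin n → ℂ}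
    (h : ∀ i, σ (a i) * σ (b i) = z i • σ (c i)) :
    pauliString n a * pauliString n b = (∏ i, z i) • pauliString n c := by
  rw [pauliString_mul_pauliString]
  ext x y
  simp [h, pauliString, Finset.prod_mul_distrib]

theorem pauliString_ne_zero (n : ℕ) (a : Fin n → Fin 4) : pauliString n a ≠ 0 := by
  intro h
  have hsq := congrFun₂ (pauliString_mul_pauliString n a a) 0 0
  simp [h, σ_mul_self] at hsq

/-- A purely imaginary fourth root of unity is `I` or `-I`. -/
theorem eq_I_or_eq_neg_I_of_star_eq_neg {z : ℂ} (hz : z ^ 4 = 1) (h : star z = -z) :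
    z = Complex.I ∨ z = -Complex.I := by
  have hre : z.re = 0 := by
    have := congrArg Complex.re h
    simp at this
    linarith
  have hsq : z ^ 2 = 1 ∨ z ^ 2 = -1 := by
    apply sq_eq_sq_iff_eq_or_eq_neg.mp
    rw [← pow_mul, hz, one_pow]
  rcases hsq with h1 | h1
  · have := congrArg Complex.re h1
    simp [pow_two, hre] at this
    nlinarith [sq_nonneg z.im]
  · exact sq_eq_sq_iff_eq_or_eq_neg.mp (h1.trans Complex.I_sq.symm)

/-- The commutator of two anticommuting normalized Pauli strings is, up to a
sign s ∈ {1, -1}, again a normalized Pauli string. -/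
theorem commutator_anticommuting_pauliStrings (n : ℕ) (hn : 1 ≤ n)
    (a b : Fin n → Fin 4)
    (hab : pauliString n a * pauliString n b = -(pauliString n b * pauliString n a)) :
    ∃ c : Fin n → Fin 4, ∃ s : ℝ, (s = 1 ∨ s = -1) ∧
      ⁅(Complex.I / 2) • pauliString n a, (Complex.I / 2) • pauliString n b⁆ =
        s • ((Complex.I / 2) • pauliString n c) := by
  choose c z hz hab' hba' using fun i => exists_σ_mul_σ (a i) (b i)
  have hmul := pauliString_mul_pauliString_of_smul hab'
  have hmul' := pauliString_mul_pauliString_of_smul hba'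
  have hpow : (∏ i, z i) ^ 4 = 1 := by simp [← Finset.prod_pow, hz]
  have hstar : star (∏ i, z i) = -∏ i, z i := by
    rw [star_prod]
    apply smul_left_injective ℂ (pauliString_ne_zero n c)
    simp only [neg_smul]
    rw [← hmul', ← hmul, hab, neg_neg]
  have hcomm : ⁅(Complex.I / 2) • pauliString n a, (Complex.I / 2) • pauliString n b⁆ =
      (-(∏ i, z i) / 2) • pauliString n c := by
    have hba : pauliString n b * pauliString n a = -((∏ i, z i) • pauliString n c) := by
      rw [← hmul, hab, neg_neg]
    rw [Ring.lie_def, smul_mul_smul_comm, smul_mul_smul_comm, hba, hmul, smul_neg, sub_neg_eq_add,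
      smul_smul, ← add_smul]
    congr 1
    linear_combination (∏ i, z i) / 2 * Complex.I_sq
  rw [hcomm]
  rcases eq_I_or_eq_neg_I_of_star_eq_neg hpow hstar with h | h
  · refine ⟨c, -1, Or.inr rfl, ?_⟩
    rw [h, neg_one_smul, ← neg_smul, neg_div]
  · refine ⟨c, 1, Or.inl rfl, ?_⟩
    rw [h, one_smul, neg_neg]
end
end
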